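/- arXiv:1704.03898 — 2 statements merged into one kernel-verified Lean document; each statement's English description precedes it below -/
import Mathlib

section
/- (Dobrinen–Laflamme–Sauer) The Rado graph has the rainbow Ramsey property: for every integer k ≥ 2, every finite graph G, every Rado graph R, and every coloring of the set of induced subgraphs of R isomorphic to G into countably many colors in which each color is used on at most k copies of G, there is an induced subgraph R' of R isomorphic to R such that each color appears on at most one copy of G inside R'. -/
/-- The extension property (defining Rado graphs): for all disjoint finite sets `U, W` of
vertices there is a vertex (outside `U ∪ W`) adjacent to every vertex of `U` and to no
vertex of `W`. -/
def ExtensionProperty {V : Type} (R : SimpleGraph V) : Prop :=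
  ∀ U W : Finset V, Disjoint U W →
    ∃ v : V, v ∉ U ∧ v ∉ W ∧ (∀ u ∈ U, R.Adj v u) ∧ (∀ w ∈ W, ¬ R.Adj v w)

section LeftIdeals

variable {S : Type*} [Semigroup S] [TopologicalSpace S] [CompactSpace S] [T2Space S]

/-- A closed nonempty left ideal of a compact right topological semigroup contains a closed
minimal left ideal. -/
theorem exists_isClosed_minimal_leftIdeal (hc : ∀ r : S, Continuous (· * r)) (I : Set S)
    (hI : IsClosed I) (hne : I.Nonempty) (hmul : ∀ x, ∀ y ∈ I, x * y ∈ I) :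
    ∃ L ⊆ I, IsClosed L ∧ L.Nonempty ∧ (∀ x, ∀ y ∈ L, x * y ∈ L) ∧
      ∀ z ∈ L, ∀ y ∈ L, ∃ x, x * z = y := by
  let T : Set (Set S) := {L | IsClosed L ∧ L.Nonempty ∧ ∀ x, ∀ y ∈ L, x * y ∈ L}
  obtain ⟨L, hLI, hL⟩ : ∃ L, L ⊆ I ∧ Minimal (· ∈ T) L := by
    refine zorn_superset_nonempty T (fun c hcs hchain hcne => ?_) I ⟨hI, hne, hmul⟩
    refine ⟨⋂₀ c, ⟨isClosed_sInter fun t ht => (hcs ht).1, ?_, fun x y hy t ht =>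
      (hcs ht).2.2 x y (hy t ht)⟩, fun s hs => Set.sInter_subset_of_mem hs⟩
    rw [Set.sInter_eq_iInter]
    have := hcne.coe_sort
    refine IsCompact.nonempty_iInter_of_directed_nonempty_isCompact_isClosed _
      (DirectedOn.directed_val (IsChain.directedOn hchain.symm)) (fun i => (hcs i.prop).2.1)
      (fun i => (hcs i.prop).1.isCompact) (fun i => (hcs i.prop).1)
  refine ⟨L, hLI, hL.prop.1, hL.prop.2.1, hL.prop.2.2, fun z hz y hy => ?_⟩
  have hsub : Set.range (· * z) ⊆ L := by
    rintro _ ⟨x, rfl⟩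
    exact hL.prop.2.2 x z hz
  have heq : Set.range (· * z) = L := by
    refine hL.eq_of_subset ⟨?_, ⟨z * z, z, rfl⟩, ?_⟩ hsub
    · exact (isCompact_range (hc z)).isClosed
    · rintro x _ ⟨y, rfl⟩
      exact ⟨x * y, mul_assoc _ _ _⟩
  rw [← heq] at hy
  exact hy

/-- A closed nonempty left ideal of a compact right topological semigroup contains an idempotent
`e` lying in a minimal left ideal. -/
theorem exists_minimal_idempotent (hc : ∀ r : S, Continuous (· * r)) (I : Set S)
    (hI : IsClosed I) (hne : I.Nonempty) (hmul : ∀ x, ∀ y ∈ I, x * y ∈ I) :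
    ∃ e ∈ I, e * e = e ∧ ∀ x, ∃ y, y * (x * e) = e := by
  obtain ⟨L, hLI, hL, hLne, hLmul, hmin⟩ := exists_isClosed_minimal_leftIdeal hc I hI hne hmul
  obtain ⟨e, he, hee⟩ := exists_idempotent_in_compact_subsemigroup hc L hLne hL.isCompact
    (fun x _ y hy => hLmul x y hy)
  exact ⟨e, hLI he, hee, fun x => hmin _ (hLmul x e he) e he⟩

/-- If `e` is an idempotent in a minimal left ideal then every `x` satisfies
`e * x * r = e` for some `r`. -/
theorem exists_mul_mul_eq_of_minimal_idempotent {T : Type*} [Semigroup T] {e : T} (hee : e * e = e)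
    (hmin : ∀ x, ∃ y, y * (x * e) = e) (x : T) : ∃ r, e * x * r = e := by
  obtain ⟨y, hy⟩ := hmin (e * x)
  obtain ⟨t, ht⟩ := hmin (e * y)
  refine ⟨e * (e * y * e), ?_⟩
  have h1 : (e * y * e) * (e * x * e) = e := by
    calc (e * y * e) * (e * x * e) = e * (y * ((e * e) * x * e)) := by simp only [mul_assoc]
      _ = e := by rw [hee, hy, hee]
  have h2 : (e * t * e) * (e * y * e) = e := by
    calc (e * t * e) * (e * y * e) = e * (t * ((e * e) * y * e)) := by simp only [mul_assoc]
      _ = e := by rw [hee, ht, hee]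
  calc e * x * (e * (e * y * e)) = (e * x * e) * (e * y * e) := by simp only [mul_assoc]
    _ = (e * e) * x * e * (e * y * e) := by rw [hee]
    _ = e * (e * x * e) * (e * y * e) := by simp only [mul_assoc]
    _ = (e * t * e) * (e * y * e) * (e * x * e) * (e * y * e) := by rw [h2]
    _ = (e * t * e) * ((e * y * e) * (e * x * e)) * (e * y * e) := by simp only [mul_assoc]
    _ = e * t * (e * e) * (e * y * e) := by rw [h1]; simp only [mul_assoc]
    _ = e := by rw [hee, h2]

end LeftIdeals

section Words

attribute [local instance] Ultrafilter.mul Ultrafilter.semigroup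

theorem Ultrafilter.map_mul_hom {M N : Type*} [Semigroup M] [Semigroup N] (f : M → N)
    (hf : ∀ x y, f (x * y) = f x * f y) (U V : Ultrafilter M) :
    (U * V).map f = U.map f * V.map f := by
  refine Ultrafilter.coe_inj.mp (Filter.ext' fun p => ?_)
  simp only [Ultrafilter.eventually_mul, Ultrafilter.coe_map, Filter.eventually_map, hf]

/-- Ultrafilters on words behind the infinitary Hales–Jewett theorem. -/
theorem exists_ultrafilter_words (A : Type) :
    ∃ (q : Ultrafilter (FreeMonoid A)) (p : Ultrafilter (FreeMonoid (Option A))),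
      ∀ a : A, q * pure (FreeMonoid.of a) * p.map (FreeMonoid.map (Option.getD · a)) = q ∧
        ∀ b : A, p.map (FreeMonoid.map (Option.getD · a)) * pure (FreeMonoid.of b) *
          p.map (FreeMonoid.map (Option.getD · b)) = p.map (FreeMonoid.map (Option.getD · a)) := by
  obtain ⟨q, -, hqq, hq⟩ := exists_minimal_idempotent
    (Ultrafilter.continuous_mul_left (M := FreeMonoid A)) Set.univ isClosed_univ
    ⟨pure 1, trivial⟩ (fun _ _ _ => trivial)
  set j : FreeMonoid A → FreeMonoid (Option A) := ⇑(FreeMonoid.map (some : A → Option A)) with hj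
  have hfill : ∀ a : A, (FreeMonoid.map (Option.getD · a)) ∘ j = id := by
    intro a
    funext w
    apply FreeMonoid.toList.injective
    simp [hj, FreeMonoid.toList_map, Function.comp_def]
  obtain ⟨e, ⟨s, hs⟩, hee, he⟩ := exists_minimal_idempotent
    (Ultrafilter.continuous_mul_left (M := FreeMonoid (Option A))) (Set.range (· * q.map j))
    (isCompact_range (Ultrafilter.continuous_mul_left _)).isClosed ⟨_, pure 1, rfl⟩
    (by rintro x _ ⟨y, rfl⟩; exact ⟨x * y, mul_assoc _ _ _⟩)
  obtain ⟨r, hr⟩ := exists_mul_mul_eq_of_minimal_idempotent hee he (pure (FreeMonoid.of none))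
  have key : ∀ a : A, q * pure (FreeMonoid.of a) *
      r.map (FreeMonoid.map (Option.getD · a)) = q := by
    intro a
    set f : FreeMonoid (Option A) → FreeMonoid A := ⇑(FreeMonoid.map (Option.getD · a)) with hf
    have hmul : ∀ U V : Ultrafilter (FreeMonoid (Option A)), (U * V).map f = U.map f * V.map f :=
      Ultrafilter.map_mul_hom f (map_mul _)
    have hfj : (q.map j).map f = q := by
      rw [Ultrafilter.map_map, hfill a, Ultrafilter.map_id]
    have hea : e.map f = s.map f * q := by
      rw [← hs, hmul, hfj]
    have heea : e.map f * e.map f = e.map f := by rw [← hmul, hee]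
    obtain ⟨x, hx⟩ := hq (s.map f)
    rw [← hea] at hx
    have hqe : q * e.map f = q := by
      rw [← hx, mul_assoc, heea]
    have h1 : e.map f * pure (FreeMonoid.of a) * r.map f = e.map f := by
      have := congrArg (Ultrafilter.map f) hr
      rw [hmul, hmul, Ultrafilter.map_pure] at this
      simpa [hf] using this
    rw [← hqe, mul_assoc, mul_assoc, ← mul_assoc (e.map f), h1]
  refine ⟨q, r * q.map j, fun a => ?_⟩
  have hmap : ∀ a : A, (r * q.map j).map (FreeMonoid.map (Option.getD · a)) =
      r.map (FreeMonoid.map (Option.getD · a)) * q := by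
    intro a
    rw [Ultrafilter.map_mul_hom _ (map_mul _), Ultrafilter.map_map]
    congr 1
    rw [hfill, Ultrafilter.map_id]
  simp only [hmap]
  refine ⟨?_, fun b => ?_⟩
  · rw [← mul_assoc, key, hqq]
  · rw [mul_assoc, mul_assoc, ← mul_assoc, ← mul_assoc, ← mul_assoc]
    rw [mul_assoc _ q, mul_assoc _ (q * _), key, mul_assoc, hqq]

/-- The word obtained from `w` by appending, for `i < n`, the letter `a i` followed by `v i` with
its gaps filled by `a i`. -/
def spliceWord {A : Type} (w : List A) (v : ℕ → List (Option A)) (a : ℕ → A) : ℕ → List A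
  | 0 => w
  | n + 1 => spliceWord w v a n ++ a n :: (v n).map (Option.getD · (a n))

/-- An infinitary left-variable Hales–Jewett theorem. -/
theorem exists_monochromatic_spliceWord {A κ : Type} [Finite A] [Finite κ] (C : List A → κ) :
    ∃ (w : List A) (v : ℕ → List (Option A)) (b : κ), ∀ (a : ℕ → A) (n : ℕ),
      C (spliceWord w v a n) = b := by
  classical
  obtain ⟨q, p, hqp⟩ := exists_ultrafilter_words A
  let C' : FreeMonoid A → κ := fun w => C w.toList
  obtain ⟨b, hb⟩ : ∃ b, ∀ᶠ w in q, C' w = b := by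
    rw [← Ultrafilter.eventually_exists_iff]
    exact Filter.Eventually.of_forall fun w => ⟨_, rfl⟩
  let Good : FreeMonoid A → Prop := fun w => C' w = b ∧ ∀ a, ∀ᶠ v in p,
    C' (w * FreeMonoid.of a * FreeMonoid.map (Option.getD · a) v) = b
  obtain ⟨w, hw⟩ : ∃ w, Good w := by
    have : ∀ᶠ w in q, Good w := by
      refine hb.and (Filter.eventually_all.2 fun a => ?_)
      have h := hb
      rw [← (hqp a).1, Ultrafilter.eventually_mul, Ultrafilter.eventually_mul] at h
      simpa using h
    exact this.exists
  have hstep : ∀ w, Good w → ∀ᶠ v in p, ∀ a,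
      Good (w * FreeMonoid.of a * FreeMonoid.map (Option.getD · a) v) := by
    intro w hw
    refine Filter.eventually_all.2 fun a => ?_
    refine (hw.2 a).and (Filter.eventually_all.2 fun c => ?_)
    have h : ∀ᶠ u in p.map (FreeMonoid.map (Option.getD · a)), C' (w * FreeMonoid.of a * u) = b :=
      hw.2 a
    rw [← (hqp a).2 c, Ultrafilter.eventually_mul, Ultrafilter.eventually_mul] at h
    simpa [mul_assoc] using h
  have hfin : ∀ s : {s : Finset (FreeMonoid A) // ∀ w ∈ s, Good w}, ∃ v, ∀ w ∈ s.1, ∀ a,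
      Good (w * FreeMonoid.of a * FreeMonoid.map (Option.getD · a) v) := by
    intro s
    exact ((Filter.eventually_all_finset s.1).2 fun w hw => hstep w (s.2 w hw)).exists
  choose nxt hnxt using hfin
  have := Fintype.ofFinite A
  let st : ℕ → {s : Finset (FreeMonoid A) // ∀ w ∈ s, Good w} := fun n =>
    Nat.rec ⟨{w}, by simpa using hw⟩ (fun _ s =>
      ⟨Finset.image₂ (fun w a => w * FreeMonoid.of a * FreeMonoid.map (Option.getD · a) (nxt s))
        s.1 Finset.univ, by
        intro u hu
        obtain ⟨w, hw, a, -, rfl⟩ := Finset.mem_image₂.1 hu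
        exact hnxt s w hw a⟩) n
  refine ⟨w.toList, fun n => (nxt (st n)).toList, b, fun a n => ?_⟩
  have hmem : FreeMonoid.ofList (spliceWord w.toList (fun n => (nxt (st n)).toList) a n) ∈
      (st n).1 := by
    induction n with
    | zero => simp [spliceWord, st]
    | succ n ih =>
      refine Finset.mem_image₂.2 ⟨_, ih, a n, Finset.mem_univ _, ?_⟩
      apply FreeMonoid.toList.injective
      simp [spliceWord, FreeMonoid.toList_map]
      rfl
  exact ((st n).2 _ hmem).1

end Words

section RigidMaps

/-- The letter `i` occurs in `f` for the first time at `n`, and only smaller letters occur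
before. -/
def IsFirstOcc (f : ℕ → ℕ) (i n : ℕ) : Prop := f n = i ∧ ∀ m < n, f m < i

/-- A rigid surjection of `ℕ`: every letter occurs, and the letters first occur in increasing
order. -/
def Rigid (f : ℕ → ℕ) : Prop := ∀ i, ∃ n, IsFirstOcc f i n

/-- The map `f` fixes every number below `l`. -/
def FixesBelow (l : ℕ) (f : ℕ → ℕ) : Prop := ∀ i < l, f i = i

/-- The colour `χ f` depends only on the values of `f` before the first occurrence of `k`. -/
def DependsBefore {κ : Type} (k : ℕ) (χ : (ℕ → ℕ) → κ) : Prop :=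
  ∀ f g n, IsFirstOcc f k n → IsFirstOcc g k n → (∀ m < n, f m = g m) → χ f = χ g

namespace IsFirstOcc

variable {f g : ℕ → ℕ} {i j m n : ℕ}

theorem comp (hg : IsFirstOcc g i m) (hf : IsFirstOcc f m n) : IsFirstOcc (g ∘ f) i n :=
  ⟨by rw [Function.comp_apply, hf.1, hg.1], fun p hp => hg.2 _ (hf.2 p hp)⟩

theorem lt_of_lt (hi : IsFirstOcc f i n) (hj : IsFirstOcc f j m) (hij : i < j) : n < m := by
  by_contra! h
  rcases h.eq_or_lt with rfl | h
  · have := hi.1; have := hj.1; omega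
  · have := hi.2 _ h; have := hj.1; omega

theorem unique (hm : IsFirstOcc f i m) (hn : IsFirstOcc f i n) : m = n := by
  rcases lt_trichotomy m n with h | h | h
  · have := hn.2 _ h; have := hm.1; omega
  · exact h
  · have := hm.2 _ h; have := hn.1; omega

theorem congr (hf : IsFirstOcc f i n) (h : ∀ m ≤ n, f m = g m) : IsFirstOcc g i n :=
  ⟨(h n le_rfl).symm.trans hf.1, fun m hm => h m hm.le ▸ hf.2 m hm⟩

end IsFirstOcc

theorem FixesBelow.isFirstOcc {l i : ℕ} {f : ℕ → ℕ} (h : FixesBelow l f) (hi : i < l) :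
    IsFirstOcc f i i :=
  ⟨h i hi, fun m hm => by rw [h m (hm.trans hi)]; exact hm⟩

theorem FixesBelow.mono {l l' : ℕ} {f : ℕ → ℕ} (h : FixesBelow l f) (hl : l' ≤ l) :
    FixesBelow l' f := fun i hi => h i (hi.trans_le hl)

theorem FixesBelow.comp {l : ℕ} {f g : ℕ → ℕ} (hg : FixesBelow l g) (hf : FixesBelow l f) :
    FixesBelow l (g ∘ f) := fun i hi => by rw [Function.comp_apply, hf i hi, hg i hi]

theorem FixesBelow.le_of_isFirstOcc {l n : ℕ} {f : ℕ → ℕ} (h : FixesBelow l f)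
    (hn : IsFirstOcc f l n) : l ≤ n := by
  by_contra! hlt
  have := h n hlt
  have := hn.1
  omega

theorem fixesBelow_id (l : ℕ) : FixesBelow l id := fun _ _ => rfl

namespace Rigid

variable {f g : ℕ → ℕ}

theorem id : Rigid id := fun i => ⟨i, rfl, fun _ h => h⟩

theorem comp (hg : Rigid g) (hf : Rigid f) : Rigid (g ∘ f) := fun i => by
  obtain ⟨m, hm⟩ := hg i
  obtain ⟨n, hn⟩ := hf m
  exact ⟨n, hm.comp hn⟩

theorem le_of_isFirstOcc (hf : Rigid f) : ∀ {i n}, IsFirstOcc f i n → i ≤ n := by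
  intro i
  induction i with
  | zero => intro n _; exact n.zero_le
  | succ i ih =>
    intro n hn
    obtain ⟨m, hm⟩ := hf i
    have := ih hm
    have := hm.lt_of_lt hn i.lt_succ_self
    omega

theorem apply_le (hf : Rigid f) (n : ℕ) : f n ≤ n := by
  obtain ⟨m, hm⟩ := hf (f n)
  have := hf.le_of_isFirstOcc hm
  by_contra! h
  exact lt_irrefl _ (hm.2 n (by omega))

end Rigid

/-- An infinite composition `⋯ ∘ V (m + 1) ∘ V m` of rigid surjections fixing more and more
letters converges. -/
theorem exists_infinite_comp (l : ℕ) (V : ℕ → ℕ → ℕ) (hV : ∀ m, Rigid (V m))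
    (hfix : ∀ m, FixesBelow (l + m) (V m)) :
    ∃ U : ℕ → ℕ → ℕ, (∀ m, Rigid (U m)) ∧ (∀ m, FixesBelow (l + m) (U m)) ∧
      ∀ m, U m = U (m + 1) ∘ V m := by
  let C : ℕ → ℕ → ℕ → ℕ := fun m s => Nat.rec id (fun s g => V (m + s) ∘ g) s
  have hC0 : ∀ m, C m 0 = id := fun m => rfl
  have hCs : ∀ m s, C m (s + 1) = V (m + s) ∘ C m s := fun m s => rfl
  have hCr : ∀ m s, Rigid (C m s) := by
    intro m s
    induction s with
    | zero => exact Rigid.id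
    | succ s ih => exact (hV _).comp ih
  have hCf : ∀ m s, FixesBelow (l + m) (C m s) := by
    intro m s
    induction s with
    | zero => exact fixesBelow_id _
    | succ s ih => exact ((hfix (m + s)).mono (by omega)).comp ih
  have hstab : ∀ m n s, n + 1 ≤ s → C m s n = C m (n + 1) n := by
    intro m n s hs
    induction s, hs using Nat.le_induction with
    | base => rfl
    | succ s hs ih =>
      have := (hCr m s).apply_le n
      rw [hCs, Function.comp_apply, hfix (m + s) _ (by omega), ih]
  have hshift : ∀ m s, C m (s + 1) = C (m + 1) s ∘ V m := by
    intro m s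
    induction s with
    | zero => rfl
    | succ s ih =>
      rw [hCs, ih, hCs, show m + (s + 1) = m + 1 + s by omega]
      rfl
  refine ⟨fun m n => C m (n + 1) n, fun m i => ?_, fun m i hi => hCf m (i + 1) i hi, fun m => ?_⟩
  · obtain ⟨n, hn⟩ := hCr m (i + 1) i
    refine ⟨n, ?_⟩
    have hlater : ∀ s, i + 1 ≤ s → IsFirstOcc (C m s) i n := by
      intro s hs
      induction s, hs using Nat.le_induction with
      | base => exact hn
      | succ s hs ih => exact ((hfix (m + s)).isFirstOcc (by omega)).comp ih
    refine (hlater (i + 1 + (n + 1)) (by omega)).congr fun p hp => ?_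
    exact hstab m p (i + 1 + (n + 1)) (by omega)
  · funext n
    have h1 := hstab (m + 1) (V m n) (n + 1) (by have := (hV m).apply_le n; omega)
    have h2 := hstab m n (n + 2) (by omega)
    rw [hshift] at h2
    simp only [Function.comp_apply] at h2 ⊢
    rw [← h1, h2]

theorem map_fill_spliceWord {l : ℕ} (w : List (Fin l)) (v : ℕ → List (Option (Fin l)))
    (P : ℕ → List ℕ) (hP0 : P 0 = List.range l ++ w.map Fin.val)
    (hPs : ∀ n, P (n + 1) = P n ++ (l + n) :: (v n).map (fun o => o.elim (l + n) Fin.val))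
    (f : ℕ → ℕ) (hf : FixesBelow l f) (a : ℕ → Fin l) (n : ℕ) (ha : ∀ i < n, f (l + i) = a i) :
    (P n).map f = List.range l ++ (spliceWord w v a n).map Fin.val := by
  induction n with
  | zero =>
    rw [hP0, List.map_append, List.map_map, spliceWord]
    congr 1
    · conv_rhs => rw [← List.map_id (List.range l)]
      exact List.map_congr_left fun i hi => hf i (List.mem_range.1 hi)
    · exact List.map_congr_left fun i _ => hf i i.2
  | succ n ih =>
    rw [hPs, List.map_append, ih (fun i hi => ha i (by omega)), spliceWord, List.map_append,
      List.map_cons, List.map_cons, ha n n.lt_succ_self, List.append_assoc, List.map_map,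
      List.map_map]
    congr 3
    refine List.map_congr_left fun o _ => ?_
    cases o with
    | none => exact ha n n.lt_succ_self
    | some x => exact hf x x.2

/-- The infinitary left-variable Hales–Jewett theorem in terms of rigid surjections. -/
theorem exists_rigid_of_dependsBefore_zero (l : ℕ) {κ : Type} [Finite κ] (χ : (ℕ → ℕ) → κ)
    (hχ : ∀ f g n, Rigid f → FixesBelow l f → Rigid g → FixesBelow l g →
      IsFirstOcc f l n → IsFirstOcc g l n → (∀ m < n, f m = g m) → χ f = χ g) :
    ∃ W b, Rigid W ∧ FixesBelow l W ∧ ∀ f, Rigid f → FixesBelow l f → χ (f ∘ W) = b := by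
  rcases l.eq_zero_or_pos with rfl | hl
  · have h0 : ∀ f, Rigid f → IsFirstOcc f 0 0 := by
      intro f hf
      obtain ⟨n, hn⟩ := hf 0
      exact ⟨Nat.le_zero.1 (hf.apply_le 0), fun m hm => by omega⟩
    exact ⟨id, χ id, Rigid.id, fixesBelow_id _, fun f hf hfl => hχ _ _ 0 hf hfl Rigid.id
      (fixesBelow_id _) (h0 f hf) (h0 _ Rigid.id) (fun m hm => by omega)⟩
  let F : List (Fin l) → ℕ → ℕ := fun w i =>
    (List.range l ++ w.map Fin.val).getD i (i - w.length)
  have hFlt : ∀ w i, i < l + w.length → F w i < l := by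
    intro w i hi
    have hmem : F w i ∈ List.range l ++ w.map Fin.val := by
      simp only [F]
      rw [List.getD_eq_getElem _ _ (by simpa using hi)]
      exact List.getElem_mem _
    rcases List.mem_append.1 hmem with h | h
    · exact List.mem_range.1 h
    · obtain ⟨x, -, hx⟩ := List.mem_map.1 h
      rw [← hx]
      exact x.2
  have hFge : ∀ w i, l + w.length ≤ i → F w i = i - w.length := by
    intro w i hi
    simp only [F]
    rw [List.getD_eq_default _ _ (by simpa using hi)]
  have hFfix : ∀ w, FixesBelow l (F w) := by
    intro w i hi
    simp only [F]
    rw [List.getD_append _ _ _ _ (by simpa using hi), List.getD_eq_getElem _ _ (by simpa using hi)]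
    simp
  have hFocc : ∀ w i, l ≤ i → IsFirstOcc (F w) i (i + w.length) := by
    intro w i hi
    refine ⟨by rw [hFge _ _ (by omega)]; omega, fun m hm => ?_⟩
    rcases lt_or_ge m (l + w.length) with h | h
    · exact (hFlt w m h).trans_le hi
    · rw [hFge _ _ h]; omega
  have hFrigid : ∀ w, Rigid (F w) := by
    intro w i
    rcases lt_or_ge i l with h | h
    · exact ⟨i, (hFfix w).isFirstOcc h⟩
    · exact ⟨_, hFocc w i h⟩
  obtain ⟨w, v, b, hb⟩ := exists_monochromatic_spliceWord (fun w => χ (F w))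
  let P : ℕ → List ℕ := fun n => Nat.rec (List.range l ++ w.map Fin.val)
    (fun n L => L ++ (l + n) :: (v n).map (fun o => o.elim (l + n) Fin.val)) n
  have hP0 : P 0 = List.range l ++ w.map Fin.val := rfl
  have hPs : ∀ n, P (n + 1) =
    P n ++ (l + n) :: (v n).map (fun o => o.elim (l + n) Fin.val) := fun n => rfl
  have hPlen : ∀ n, l + n ≤ (P n).length := by
    intro n
    induction n with
    | zero => simp [hP0]
    | succ n ih => rw [hPs]; simp; omega
  have hPlt : ∀ n, ∀ x ∈ P n, x < l + n := by
    intro n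
    induction n with
    | zero =>
      intro x hx
      rw [hP0] at hx
      rcases List.mem_append.1 hx with h | h
      · exact List.mem_range.1 h
      · obtain ⟨y, -, rfl⟩ := List.mem_map.1 h
        exact y.2
    | succ n ih =>
      intro x hx
      rw [hPs] at hx
      rcases List.mem_append.1 hx with h | h
      · have := ih x h; omega
      · rcases List.mem_cons.1 h with rfl | h
        · omega
        · obtain ⟨o, -, rfl⟩ := List.mem_map.1 h
          cases o with
          | none => simp
          | some y => have := y.2; simp only [Option.elim]; omega
  have hPpre : ∀ n n', n ≤ n' → P n <+: P n' := by
    intro n n' h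
    induction n', h using Nat.le_induction with
    | base => exact List.prefix_rfl
    | succ n' h ih => exact ih.trans (hPs n' ▸ List.prefix_append _ _)
  let W : ℕ → ℕ := fun i => (P (i + 1)).getD i 0
  have hW : ∀ n i, (hi : i < (P n).length) → W i = (P n)[i] := by
    intro n i hi
    have hi' : i < (P (i + 1)).length := by have := hPlen (i + 1); omega
    simp only [W]
    rw [List.getD_eq_getElem _ _ hi']
    rcases le_total n (i + 1) with h | h
    · exact ((hPpre _ _ h).getElem hi).symm
    · exact (hPpre _ _ h).getElem hi'
  have hWocc : ∀ n, IsFirstOcc W (l + n) (P n).length := by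
    intro n
    refine ⟨?_, fun m hm => ?_⟩
    · rw [hW (n + 1) _ (by simp [hPs])]
      simp [hPs]
    · rw [hW n m hm]
      exact hPlt n _ (List.getElem_mem _)
  have hWfix : FixesBelow l W := by
    intro i hi
    rw [hW 0 i (by have := hPlen 0; omega)]
    simp [hP0, List.getElem_append_left, hi]
  have hWr : Rigid W := by
    intro i
    rcases lt_or_ge i l with h | h
    · exact ⟨i, hWfix.isFirstOcc h⟩
    · obtain ⟨n, rfl⟩ := Nat.exists_eq_add_of_le h
      exact ⟨_, hWocc n⟩
  refine ⟨W, b, hWr, hWfix, fun f hf hfl => ?_⟩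
  obtain ⟨q, hq⟩ := hf l
  obtain ⟨n, rfl⟩ := Nat.exists_eq_add_of_le (hfl.le_of_isFirstOcc hq)
  have : NeZero l := ⟨hl.ne'⟩
  let a : ℕ → Fin l := fun i => Fin.ofNat l (f (l + i))
  have ha : ∀ i < n, f (l + i) = a i := fun i hi =>
    (Nat.mod_eq_of_lt (hq.2 (l + i) (by omega))).symm
  have hmap := map_fill_spliceWord w v P hP0 hPs f hfl a n ha
  have hlen : (P n).length = l + (spliceWord w v a n).length := by
    have := congrArg List.length hmap
    simpa using this
  rw [← hb a n]
  refine hχ _ _ (P n).length (hf.comp hWr) (hfl.comp hWfix) (hFrigid _) (hFfix _)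
    (hq.comp (hWocc n)) (hlen ▸ hFocc _ l le_rfl) fun m hm => ?_
  rw [Function.comp_apply, hW n m hm]
  simp only [F]
  rw [← hmap, List.getD_eq_getElem _ _ (by simpa using hm), List.getElem_map]

/-- A rigid surjection fixing the letters below `l` factors through the extension by new letters
of its part before the first occurrence of `l`. -/
theorem Rigid.exists_eq_comp {l j : ℕ} {f : ℕ → ℕ} (hf : Rigid f) (hfl : FixesBelow l f)
    (hj : IsFirstOcc f l j) (w : Fin j → Fin l) (hw : ∀ i, (w i : ℕ) = f i) :
    ∃ h, Rigid h ∧ FixesBelow (j + 1) h ∧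
      f = (fun i => if hi : i < j then (w ⟨i, hi⟩ : ℕ) else l + (i - j)) ∘ h := by
  have hlj := hfl.le_of_isFirstOcc hj
  let h : ℕ → ℕ := fun i => if i ≤ j then i else if f i < l then f i else j + (f i - l)
  have hfix : FixesBelow (j + 1) h := fun i hi => if_pos (by omega)
  refine ⟨h, fun i => ?_, hfix, ?_⟩
  · rcases lt_or_ge i (j + 1) with hi | hi
    · exact ⟨i, hfix.isFirstOcc hi⟩
    · obtain ⟨n, hn⟩ := hf (l + (i - j))
      have hjn := hj.lt_of_lt hn (by omega)
      refine ⟨n, ?_, fun m hm => ?_⟩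
      · have := hn.1
        simp only [h]
        split_ifs <;> omega
      · have := hn.2 m hm
        simp only [h]
        split_ifs <;> omega
  · funext i
    simp only [Function.comp_apply, h, hw]
    rcases lt_trichotomy i j with hi | rfl | hi
    · simp [hi, hi.le]
    · simpa using hj.1
    · rw [if_neg (by omega)]
      by_cases hfi : f i < l
      · rw [if_pos hfi, dif_pos (by omega), hfl _ hfi]
      · rw [if_neg hfi, dif_neg (by omega)]
        omega

/-- The infinite dual Ramsey theorem of Carlson and Simpson. -/
theorem exists_rigid_of_dependsBefore (d : ℕ) : ∀ (l : ℕ) {κ : Type} [Finite κ]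
    (χ : (ℕ → ℕ) → κ), DependsBefore (l + d) χ →
    ∃ W b, Rigid W ∧ FixesBelow l W ∧ ∀ f, Rigid f → FixesBelow l f → χ (f ∘ W) = b := by
  induction d with
  | zero =>
    intro l κ _ χ hχ
    exact exists_rigid_of_dependsBefore_zero l χ fun f g n _ _ _ _ => hχ f g n
  | succ d ih =>
    intro l κ _ χ hχ
    let E : (m : ℕ) → (Fin (l + m) → Fin l) → ℕ → ℕ := fun m w i =>
      if hi : i < l + m then (w ⟨i, hi⟩ : ℕ) else l + (i - (l + m))
    have hE : ∀ m w, IsFirstOcc (E m w) (l + (d + 1)) (l + m + 1 + d) := by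
      intro m w
      refine ⟨?_, fun i hi => ?_⟩
      · simp only [E]
        rw [dif_neg (by omega)]
        omega
      · simp only [E]
        split_ifs with h
        · have := (w ⟨i, h⟩).2
          omega
        · omega
    have hstep : ∀ (m : ℕ) (Z : {f : ℕ → ℕ // Rigid f}),
        ∃ (V : ℕ → ℕ) (b : (Fin (l + m) → Fin l) → κ), Rigid V ∧ FixesBelow (l + m + 1) V ∧
          ∀ h, Rigid h → FixesBelow (l + m + 1) h → ∀ w, χ (E m w ∘ (h ∘ V) ∘ Z.1) = b w := by
      intro m Z
      obtain ⟨V, b, hV, hVl, hb⟩ := ih (l + m + 1) (fun h w => χ (E m w ∘ h ∘ Z.1)) (by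
        intro f g n hf hg hfg
        funext w
        obtain ⟨p, hp⟩ := Z.2 n
        refine hχ _ _ p ((hE m w).comp (hf.comp hp)) ((hE m w).comp (hg.comp hp)) fun q hq => ?_
        simp only [Function.comp_apply]
        rw [hfg _ (hp.2 q hq)])
      exact ⟨V, b, hV, hVl, fun h hh hhl w => congrFun (hb h hh hhl) w⟩
    choose V b hV hVl hb using hstep
    let Z : ℕ → {f : ℕ → ℕ // Rigid f} := fun m =>
      Nat.rec ⟨id, Rigid.id⟩ (fun m Z => ⟨V m Z ∘ Z.1, (hV m Z).comp Z.2⟩) m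
    have hZ : ∀ m, (Z (m + 1)).1 = V m (Z m) ∘ (Z m).1 := fun m => rfl
    obtain ⟨U, hU, hUl, hUV⟩ := exists_infinite_comp l (fun m => V m (Z m)) (fun m => hV _ _)
      (fun m => (hVl m (Z m)).mono (by omega))
    have hU0 : ∀ m, U 0 = U m ∘ (Z m).1 := by
      intro m
      induction m with
      | zero => rfl
      | succ m ihm => rw [ihm, hUV m, hZ]; rfl
    have hcol : ∀ f, Rigid f → FixesBelow l f → ∀ m, IsFirstOcc f l (l + m) →
        ∀ w : Fin (l + m) → Fin l, (∀ i, (w i : ℕ) = f i) → χ (f ∘ U 0) = b m (Z m) w := by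
      intro f hf hfl m hm w hw
      obtain ⟨h, hh, hhl, hfh⟩ := hf.exists_eq_comp hfl hm w hw
      rw [← hb m (Z m) (h ∘ U (m + 1)) (hh.comp (hU _)) (hhl.comp (hUl (m + 1))), hU0 (m + 1), hZ]
      conv_lhs => rw [hfh]
      rfl
    obtain ⟨W, c, hW, hWl, hc⟩ := exists_rigid_of_dependsBefore_zero l (fun f => χ (f ∘ U 0)) (by
      intro f g n hf hfl hg hgl hfn hgn hfg
      obtain ⟨m, rfl⟩ := Nat.exists_eq_add_of_le (hfl.le_of_isFirstOcc hfn)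
      let w : Fin (l + m) → Fin l := fun i => ⟨f i, hfn.2 i i.2⟩
      rw [hcol f hf hfl m hfn w fun i => rfl,
        hcol g hg hgl m hgn w fun i => hfg i i.2])
    exact ⟨W ∘ U 0, c, hW.comp (hU 0), hWl.comp (hUl 0), hc⟩

end RigidMaps

section WordGraph

/-- The graph on binary words in which `s` and `t` with `s.length < t.length` are adjacent when
`t` has the letter `true` at position `s.length`. -/
def wordGraph : SimpleGraph (List Bool) where
  Adj s t := t[s.length]? = some true ∨ s[t.length]? = some true
  symm := ⟨fun _ _ h => h.symm⟩
  loopless := ⟨fun s h => by simp at h⟩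

theorem wordGraph_adj_of_length_lt {s t : List Bool} (h : s.length < t.length) :
    wordGraph.Adj s t ↔ t[s.length]? = some true := by
  refine ⟨fun hst => hst.resolve_right fun h' => ?_, Or.inl⟩
  rw [List.getElem?_eq_none h.le] at h'
  simp at h'

/-- The first position at which `f` takes a value at least `i`. -/
noncomputable def firstPos (f : ℕ → ℕ) (i : ℕ) : ℕ := sInf {n | i ≤ f n}

theorem IsFirstOcc.firstPos_eq {f : ℕ → ℕ} {i n : ℕ} (h : IsFirstOcc f i n) :
    firstPos f i = n := by
  refine le_antisymm (Nat.sInf_le h.1.ge) (le_csInf ⟨n, h.1.ge⟩ fun m hm => ?_)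
  by_contra! hlt
  exact absurd (h.2 m hlt) (not_lt.2 hm)

theorem IsFirstOcc.firstPos_congr {f g : ℕ → ℕ} {k n i : ℕ} (hf : IsFirstOcc f k n)
    (hg : IsFirstOcc g k n) (hfg : ∀ m < n, f m = g m) (hi : i ≤ k) :
    firstPos f i = firstPos g i ∧ firstPos f i ≤ n := by
  have key : ∀ {f g : ℕ → ℕ}, IsFirstOcc f k n → IsFirstOcc g k n → (∀ m < n, f m = g m) →
      firstPos f i ≤ firstPos g i := by
    intro f g hf hg hfg
    refine le_csInf ⟨n, hg.1.ge.trans' hi⟩ fun m hm => ?_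
    rcases lt_or_ge m n with h | h
    · exact Nat.sInf_le (by rw [Set.mem_ofPred_eq, hfg m h]; exact hm)
    · exact (Nat.sInf_le (s := {n | i ≤ f n}) (show i ≤ f n from hf.1.ge.trans' hi)).trans h
  exact ⟨le_antisymm (key hf hg hfg) (key hg hf fun m hm => (hfg m hm).symm),
    Nat.sInf_le (show i ≤ f n from hf.1.ge.trans' hi)⟩

/-- The word with letters `z (f 0), z (f 1), …` up to the first position where `f` reaches `i`. -/
noncomputable def pullWord (z : ℕ → Bool) (f : ℕ → ℕ) (i : ℕ) : List Bool :=
  (List.range (firstPos f i)).map (z ∘ f)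

theorem pullWord_congr {z z' : ℕ → Bool} {f f' : ℕ → ℕ} {i i' : ℕ}
    (h : firstPos f i = firstPos f' i') (hz : ∀ p < firstPos f i, z (f p) = z' (f' p)) :
    pullWord z f i = pullWord z' f' i' := by
  rw [pullWord, pullWord, ← h]
  exact List.map_congr_left fun p hp => hz p (List.mem_range.1 hp)

end WordGraph

section Encoding

/-- Any sequence over a finite alphabet is, on any initial segment, the image of a rigid
surjection with few letters. -/
theorem exists_rigid_factor {Λ : Type} [Finite Λ] (s : ℕ → Λ) (M : ℕ) :
    ∃ (u : ℕ → ℕ) (d : ℕ → Λ), Rigid u ∧ ∀ p < M, u p < Nat.card Λ ∧ d (u p) = s p := by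
  obtain ⟨u, d, K, hu, hd, hlt, hM⟩ : ∃ (u : ℕ → ℕ) (d : ℕ → Λ) (K : ℕ), Rigid u ∧
      Set.InjOn d (Set.Iio K) ∧ (∀ p < M, u p < K ∧ d (u p) = s p) ∧ ∀ i, u (M + i) = K + i := by
    induction M with
    | zero => exact ⟨id, fun _ => s 0, 0, Rigid.id, fun x hx => by simp at hx, by simp, by simp⟩
    | succ M ih =>
      obtain ⟨u, d, K, hu, hd, hlt, hM⟩ := ih
      by_cases hex : ∃ a < K, d a = s M
      · obtain ⟨a, haK, ha⟩ := hex
        let u' : ℕ → ℕ := fun p => if p < M then u p else if p = M then a else u p - 1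
        have h1 : ∀ p < M, u' p = u p := fun p hp => if_pos hp
        have h2 : u' M = a := by simp [u']
        have h3 : ∀ i, u' (M + 1 + i) = K + i := by
          intro i
          have := hM (1 + i)
          simp only [u']
          rw [if_neg (by omega), if_neg (by omega), add_assoc, this]
          omega
        refine ⟨u', d, K, fun i => ?_, hd, fun p hp => ?_, h3⟩
        · rcases lt_or_ge i K with hi | hi
          · obtain ⟨n, hn⟩ := hu i
            have hnM : n < M := by
              by_contra! h
              obtain ⟨t, rfl⟩ := Nat.exists_eq_add_of_le h
              have := hn.1
              rw [hM] at this
              omega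
            exact ⟨n, hn.congr fun m hm => (h1 m (by omega)).symm⟩
          · obtain ⟨t, rfl⟩ := Nat.exists_eq_add_of_le hi
            refine ⟨M + 1 + t, h3 t, fun m hm => ?_⟩
            rcases lt_trichotomy m M with h | rfl | h
            · rw [h1 m h]
              have := (hlt m h).1
              omega
            · omega
            · obtain ⟨t', rfl⟩ := Nat.exists_eq_add_of_le (Nat.succ_le_of_lt h)
              have := h3 t'
              rw [Nat.succ_eq_add_one, this]
              omega
        · rcases Nat.lt_succ_iff_lt_or_eq.1 hp with h | rfl
          · rw [h1 p h]
            exact hlt p h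
          · rw [h2]
            exact ⟨haK, ha⟩
      · push Not at hex
        refine ⟨u, Function.update d K (s M), K + 1, hu, ?_, fun p hp => ?_, fun i => ?_⟩
        · intro x hx y hy hxy
          simp only [Set.mem_Iio] at hx hy
          by_cases hxK : x = K <;> by_cases hyK : y = K
          · omega
          · rw [hxK, Function.update_self, Function.update_of_ne hyK] at hxy
            exact absurd hxy.symm (hex y (by omega))
          · rw [hyK, Function.update_self, Function.update_of_ne hxK] at hxy
            exact absurd hxy (hex x (by omega))
          · rw [Function.update_of_ne hxK, Function.update_of_ne hyK] at hxy
            exact hd (Set.mem_Iio.2 (by omega)) (Set.mem_Iio.2 (by omega)) hxy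
        · rcases Nat.lt_succ_iff_lt_or_eq.1 hp with h | rfl
          · have := hlt p h
            rw [Function.update_of_ne (by omega)]
            exact ⟨by omega, this.2⟩
          · have := hM 0
            simp only [add_zero] at this
            rw [this, Function.update_self]
            exact ⟨by omega, rfl⟩
        · have := hM (1 + i)
          rw [add_assoc, this]
          omega
  have hK : K ≤ Nat.card Λ := by
    have h := Nat.card_le_card_of_injective (fun i : Fin K => d i)
      (fun i j hij => Fin.ext (hd (Set.mem_Iio.2 i.2) (Set.mem_Iio.2 j.2) hij))
    simpa using h
  exact ⟨u, d, hu, fun p hp => ⟨(hlt p hp).1.trans_le hK, (hlt p hp).2⟩⟩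

/-- There is a rigid surjection below which the equality of the colours of two sets of coded
vertices is canonical. -/
theorem exists_rigid_canonical {ω V : Type} [Finite ω] (ι : List Bool → V) (c : Set V → ℕ)
    (z : ℕ → ℕ → Bool) (len : ℕ → ℕ) :
    ∃ W, Rigid W ∧ ∀ (α β : ω → ℕ) (h h' : ℕ → ℕ), Rigid h → Rigid h' →
      let S := fun (h : ℕ → ℕ) (α : ω → ℕ) =>
        Set.range fun x => ι (pullWord (z (α x)) (h ∘ W) (len (α x)))
      (c (S h α) = c (S h β) ↔ c (S h' α) = c (S h' β)) := by
  let T := ω ⊕ ω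
  let K := Nat.card (T → Option Bool)
  let bit : (Fin K → T → Option Bool) → T → ℕ → Bool := fun d e x =>
    if hx : x < K then (d ⟨x, hx⟩ e).getD false else false
  let dec : (Fin K → T → Option Bool) × (T → Fin K) → (ℕ → ℕ) → T → V := fun τ f e =>
    ι (pullWord (bit τ.1 e) f (τ.2 e))
  let χ : (ℕ → ℕ) → (Fin K → T → Option Bool) × (T → Fin K) → Prop := fun f τ =>
    c (Set.range (dec τ f ∘ Sum.inl)) = c (Set.range (dec τ f ∘ Sum.inr))
  obtain ⟨W, b, hW, -, hb⟩ := exists_rigid_of_dependsBefore K 0 χ (by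
    intro f g n hf hg hfg
    have hdec : ∀ τ, dec τ f = dec τ g := by
      intro τ
      funext e
      obtain ⟨h1, h2⟩ := hf.firstPos_congr hg hfg (i := τ.2 e) (by have := (τ.2 e).2; omega)
      exact congrArg ι (pullWord_congr h1 fun p hp => by rw [hfg p (by omega)])
    funext τ
    simp only [χ, hdec])
  refine ⟨W, hW, fun α β => ?_⟩
  let i : T → ℕ := Sum.elim α β
  obtain ⟨M, hM⟩ : ∃ M, ∀ e, len (i e) < M := by
    obtain ⟨M, hM⟩ := (Set.finite_range fun e => len (i e)).bddAbove
    exact ⟨M + 1, fun e => Nat.lt_succ_of_le (hM ⟨e, rfl⟩)⟩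
  obtain ⟨u, d, hu, hud⟩ := exists_rigid_factor
    (fun p e => if p < len (i e) then some (z (i e) p) else none : ℕ → T → Option Bool) M
  let τ : (Fin K → T → Option Bool) × (T → Fin K) :=
    ⟨fun x => d x, fun e => ⟨u (len (i e)), (hud _ (hM e)).1⟩⟩
  have hocc : ∀ e, IsFirstOcc u (u (len (i e))) (len (i e)) := by
    intro e
    obtain ⟨n, hn⟩ := hu (u (len (i e)))
    have hle : n ≤ len (i e) := by
      by_contra! h
      exact lt_irrefl _ (hn.2 _ h)
    rcases hle.eq_or_lt with h | h
    · rwa [h] at hn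
    · have h1 := congrFun (hud n (h.trans (hM e))).2 e
      have h2 := congrFun (hud _ (hM e)).2 e
      rw [hn.1, h2] at h1
      simp [h] at h1
  have hdec : ∀ h, Rigid h → ∀ e,
      dec τ ((u ∘ h) ∘ W) e = ι (pullWord (z (i e)) (h ∘ W) (len (i e))) := by
    intro h hh e
    obtain ⟨n, hn⟩ := (hh.comp hW) (len (i e))
    have hfirst := ((hocc e).comp hn).firstPos_eq
    refine congrArg ι (pullWord_congr (hfirst.trans hn.firstPos_eq.symm) fun p hp => ?_)
    have hp' : (h ∘ W) p < len (i e) := hn.2 p (lt_of_lt_of_eq hp hfirst)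
    obtain ⟨h1, h2⟩ := hud _ (hp'.trans (hM e))
    have h3 := congrFun h2 e
    simp only [if_pos hp'] at h3
    simp only [bit, τ, Function.comp_apply] at h1 h3 ⊢
    rw [dif_pos h1, h3]
    rfl
  have hiff : ∀ h, Rigid h →
      (c (Set.range fun x => ι (pullWord (z (α x)) (h ∘ W) (len (α x)))) =
        c (Set.range fun x => ι (pullWord (z (β x)) (h ∘ W) (len (β x)))) ↔ b τ) := by
    intro h hh
    have h1 := congrFun (hb (u ∘ h) (hu.comp hh) (fun i hi => absurd hi i.not_lt_zero)) τ
    rw [← h1]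
    simp only [χ]
    have h2 : ∀ e, dec τ ((u ∘ h) ∘ W) e = _ := hdec h hh
    simp only [Function.comp_def] at h2 ⊢
    simp only [h2]
    rfl
  intro h h' hh hh'
  exact (hiff h hh).trans (hiff h' hh').symm

/-- A rigid surjection that delays the first occurrence of `m` to `m + i`, for `i ≤ k`. -/
def delay (m k i p : ℕ) : ℕ :=
  if p < m then p else if p < m + i then m - 1 else if p ≤ m + k then m else p - k

variable {m k i : ℕ}

theorem isFirstOcc_delay_of_lt {j : ℕ} (hj : j < m) : IsFirstOcc (delay m k i) j j := by
  refine ⟨if_pos hj, fun p hp => ?_⟩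
  rw [delay, if_pos (by omega)]
  exact hp

theorem isFirstOcc_delay_self (hm : 0 < m) (hi : i ≤ k) :
    IsFirstOcc (delay m k i) m (m + i) := by
  refine ⟨?_, fun p hp => ?_⟩ <;> unfold delay <;> split_ifs <;> omega

theorem isFirstOcc_delay_of_gt {j : ℕ} (hi : i ≤ k) (hj : m < j) :
    IsFirstOcc (delay m k i) j (j + k) := by
  refine ⟨?_, fun p hp => ?_⟩ <;> unfold delay <;> split_ifs <;> omega

theorem rigid_delay (hm : 0 < m) (hi : i ≤ k) : Rigid (delay m k i) := fun j => by
  rcases lt_trichotomy j m with h | rfl | h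
  · exact ⟨_, isFirstOcc_delay_of_lt h⟩
  · exact ⟨_, isFirstOcc_delay_self hm hi⟩
  · exact ⟨_, isFirstOcc_delay_of_gt hi h⟩

theorem delay_div_two (s k i p : ℕ) (hi : i ≤ k) :
    delay (2 * s + 1) k i p / 2 = delay (2 * s + 1) k 0 p / 2 := by
  unfold delay
  split_ifs <;> omega

open Classical in
/-- The `p`-th bit used to code the vertex `i` of a graph on `ℕ`; every adjacency is repeated. -/
noncomputable def adjBit (Q : SimpleGraph ℕ) (i p : ℕ) : Bool := decide (Q.Adj i (p / 2))

theorem length_pullWord (z : ℕ → Bool) {f : ℕ → ℕ} {i n : ℕ} (h : IsFirstOcc f i n) :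
    (pullWord z f i).length = n := by
  rw [pullWord, List.length_map, List.length_range, h.firstPos_eq]

theorem wordGraph_adj_pullWord (Q : SimpleGraph ℕ) {F : ℕ → ℕ} (hF : Rigid F) {i j : ℕ}
    (hij : i < j) : wordGraph.Adj (pullWord (adjBit Q i) F (2 * i + 1))
      (pullWord (adjBit Q j) F (2 * j + 1)) ↔ Q.Adj i j := by
  obtain ⟨n, hn⟩ := hF (2 * i + 1)
  obtain ⟨m, hm⟩ := hF (2 * j + 1)
  have hnm := hn.lt_of_lt hm (by omega)
  rw [wordGraph_adj_of_length_lt (by rw [length_pullWord _ hn, length_pullWord _ hm]; exact hnm),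
    length_pullWord _ hn, pullWord, hm.firstPos_eq]
  have : (2 * i + 1) / 2 = i := by omega
  simp [hnm, adjBit, hn.1, this, Q.adj_comm]

/-- Every rigid surjection gives an embedding of a graph on `ℕ` into the graph of binary words. -/
noncomputable def wordEmbedding (Q : SimpleGraph ℕ) (F : ℕ → ℕ) (hF : Rigid F) :
    Q ↪g wordGraph where
  toFun i := pullWord (adjBit Q i) F (2 * i + 1)
  inj' i j hij := by
    obtain ⟨n, hn⟩ := hF (2 * i + 1)
    obtain ⟨m, hm⟩ := hF (2 * j + 1)
    have h := congrArg List.length hij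
    simp only [length_pullWord _ hn, length_pullWord _ hm] at h
    have h1 := hn.1
    have h2 := hm.1
    rw [h] at h1
    omega
  map_rel_iff' {i j} := by
    rcases lt_trichotomy i j with h | rfl | h
    · exact wordGraph_adj_pullWord Q hF h
    · simp
    · rw [SimpleGraph.adj_comm, Q.adj_comm]
      exact wordGraph_adj_pullWord Q hF h

theorem pullWord_delay_of_ne (Q : SimpleGraph ℕ) {W : ℕ → ℕ} (hW : Rigid W) {s a k i : ℕ}
    (ha : a ≠ s) (hi : i ≤ k) :
    pullWord (adjBit Q a) (delay (2 * s + 1) k i ∘ W) (2 * a + 1) =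
      pullWord (adjBit Q a) (delay (2 * s + 1) k 0 ∘ W) (2 * a + 1) := by
  refine pullWord_congr ?_ fun p _ => ?_
  · rcases lt_or_gt_of_ne ha with h | h
    · obtain ⟨n, hn⟩ := hW (2 * a + 1)
      rw [((isFirstOcc_delay_of_lt (by omega)).comp hn).firstPos_eq,
        ((isFirstOcc_delay_of_lt (by omega)).comp hn).firstPos_eq]
    · obtain ⟨n, hn⟩ := hW (2 * a + 1 + k)
      rw [((isFirstOcc_delay_of_gt hi (by omega)).comp hn).firstPos_eq,
        ((isFirstOcc_delay_of_gt k.zero_le (by omega)).comp hn).firstPos_eq]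
  · rw [adjBit, adjBit, Function.comp_apply, Function.comp_apply, delay_div_two s k i _ hi]

end Encoding

section Universal

variable {V : Type} {R : SimpleGraph V}

open Classical in
/-- Vertices chosen one after the other, with adjacencies prescribed by `H`. -/
noncomputable def greedySeq (next : Finset V → Finset V → V) (H : SimpleGraph ℕ) : ℕ → V
  | n =>
    next ((Finset.univ.filter fun m : Fin n => H.Adj n m).image
        fun m : Fin n => greedySeq next H m)
      ((Finset.univ : Finset (Fin n)).image fun m : Fin n => greedySeq next H m)
termination_by n => n
decreasing_by all_goals exact m.2

/-- A graph with the extension property contains every countable graph as an induced subgraph. -/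
theorem ExtensionProperty.nonempty_embedding_nat (hR : ExtensionProperty R) (H : SimpleGraph ℕ) :
    Nonempty (H ↪g R) := by
  classical
  have hnext : ∀ U W : Finset V, ∃ v, v ∉ U ∧ v ∉ W ∧ (∀ u ∈ U, R.Adj v u) ∧
      ∀ w ∈ W, w ∉ U → ¬ R.Adj v w := by
    intro U W
    obtain ⟨v, h1, h2, h3, h4⟩ := hR U (W \ U) Finset.disjoint_sdiff
    refine ⟨v, h1, fun h => h2 (Finset.mem_sdiff.2 ⟨h, h1⟩), h3, fun w hw hwU => ?_⟩
    exact h4 w (Finset.mem_sdiff.2 ⟨hw, hwU⟩)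
  choose next h1 h2 h3 h4 using hnext
  let f := greedySeq next H
  have hne : ∀ m n, m < n → f n ≠ f m := by
    intro m n hmn heq
    have := h2 ((Finset.univ.filter fun m : Fin n => H.Adj n m).image fun m : Fin n => f m)
      ((Finset.univ : Finset (Fin n)).image fun m : Fin n => f m)
    refine this (Finset.mem_image.2 ⟨⟨m, hmn⟩, Finset.mem_univ _, ?_⟩)
    simp only [← heq]
    simp only [f]
    rw [greedySeq]
  have hinj : Function.Injective f := by
    intro m n hmn
    rcases lt_trichotomy m n with h | h | h
    · exact absurd hmn.symm (hne m n h)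
    · exact h
    · exact absurd hmn (hne n m h)
  have hadj : ∀ m n, m < n → (R.Adj (f n) (f m) ↔ H.Adj n m) := by
    intro m n hmn
    have hf : f n = next ((Finset.univ.filter fun m : Fin n => H.Adj n m).image
        fun m : Fin n => f m) ((Finset.univ : Finset (Fin n)).image fun m : Fin n => f m) := by
      simp only [f]
      rw [greedySeq]
    constructor
    · intro h
      by_contra hH
      rw [hf] at h
      refine h4 _ _ (f m) (Finset.mem_image.2 ⟨⟨m, hmn⟩, Finset.mem_univ _, rfl⟩) ?_ h
      intro hm
      obtain ⟨p, hp, hpm⟩ := Finset.mem_image.1 hm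
      have := hinj hpm
      rw [← this] at hH
      exact hH (Finset.mem_filter.1 hp).2
    · intro h
      rw [hf]
      exact h3 _ _ (f m) (Finset.mem_image.2
        ⟨⟨m, hmn⟩, Finset.mem_filter.2 ⟨Finset.mem_univ _, h⟩, rfl⟩)
  refine ⟨⟨⟨f, hinj⟩, fun {m n} => ?_⟩⟩
  rcases lt_trichotomy m n with h | rfl | h
  · rw [R.adj_comm, H.adj_comm]
    exact hadj m n h
  · simp
  · exact hadj n m h

theorem ExtensionProperty.nonempty_embedding (hR : ExtensionProperty R) {α : Type} [Countable α]
    (H : SimpleGraph α) : Nonempty (H ↪g R) := by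
  obtain ⟨f, hf⟩ := exists_injective_nat α
  obtain ⟨φ⟩ := hR.nonempty_embedding_nat (H.map f)
  exact ⟨φ.comp (SimpleGraph.Embedding.map ⟨f, hf⟩ H)⟩

end Universal

/-- **Dobrinen–Laflamme–Sauer.** The Rado graph has the rainbow Ramsey property: for every
`k ≥ 2`, every finite graph `G`, every Rado graph `R`, and every coloring of the induced
copies of `G` in `R` into countably many colors in which each color is used on at most `k`
copies, there is an induced subgraph of `R` isomorphic to `R` inside which each color
appears on at most one copy of `G`. -/
theorem rado_rainbow_ramsey {W : Type} [Fintype W] (G : SimpleGraph W) (k : ℕ) (hk : 2 ≤ k)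
    {V : Type} [Countable V] (R : SimpleGraph V) (hR : ExtensionProperty R)
    (c : Set V → ℕ)
    (hbd : ∀ j : ℕ, ∃ F : Finset (Set V), F.card ≤ k ∧
      ∀ S : Set V, Nonempty (G ≃g R.induce S) → c S = j → S ∈ F) :
    ∃ V' : Set V, Nonempty (R ≃g R.induce V') ∧
      ∀ S₁ S₂ : Set V, S₁ ⊆ V' → S₂ ⊆ V' →
        Nonempty (G ≃g R.induce S₁) → Nonempty (G ≃g R.induce S₂) →
        c S₁ = c S₂ → S₁ = S₂ := by
    classical
  have hinf : Infinite V := by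
    refine Infinite.of_not_fintype fun hfin => ?_
    obtain ⟨v, hv, -⟩ := hR Finset.univ ∅ (Finset.disjoint_empty_right _)
    exact hv (Finset.mem_univ v)
  obtain ⟨ν⟩ : Nonempty (ℕ ≃ V) := by
    obtain ⟨_⟩ := nonempty_denumerable V
    exact ⟨(Denumerable.eqv V).symm⟩
  obtain ⟨ι⟩ := hR.nonempty_embedding wordGraph
  let Q : SimpleGraph ℕ := R.comap ν
  let e : Q ≃g R := SimpleGraph.Iso.comap ν R
  obtain ⟨F, hF, hcan⟩ := exists_rigid_canonical (ω := W) ι c (adjBit Q) fun a => 2 * a + 1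
  let φ : (h : ℕ → ℕ) → Rigid h → Q ↪g R := fun h hh =>
    ι.comp (wordEmbedding Q (h ∘ F) (hh.comp hF))
  have hφ : ∀ h hh a, φ h hh a = ι (pullWord (adjBit Q a) (h ∘ F) (2 * a + 1)) :=
    fun _ _ _ => rfl
  have hlift : ∀ S ⊆ Set.range (φ id Rigid.id), Nonempty (G ≃g R.induce S) →
      ∃ α : G ↪g Q, S = Set.range fun x => φ id Rigid.id (α x) := by
    rintro S hS ⟨ψ⟩
    choose α hα using fun x : W => hS (ψ x).2
    have hadj : ∀ {x y}, Q.Adj (α x) (α y) ↔ G.Adj x y := by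
      intro x y
      rw [← (φ id Rigid.id).map_adj_iff, hα, hα, ← ψ.map_adj_iff]
      rfl
    have hinj : Function.Injective α := by
      intro x y hxy
      have := congrArg (φ id Rigid.id) hxy
      rw [hα, hα] at this
      exact ψ.injective (Subtype.ext this)
    refine ⟨⟨⟨α, hinj⟩, hadj⟩, ?_⟩
    ext v
    constructor
    · intro hv
      refine ⟨ψ.symm ⟨v, hv⟩, (hα _).trans ?_⟩
      simp
    · rintro ⟨x, rfl⟩
      have hx : φ id Rigid.id (α x) ∈ S := (hα x).symm ▸ (ψ x).2
      exact hx
  refine ⟨Set.range (φ id Rigid.id),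
    ⟨e.symm.trans (φ id Rigid.id).isoInduceRange⟩, ?_⟩
  intro S₁ S₂ hS₁ hS₂ hG₁ hG₂ hc
  obtain ⟨α, rfl⟩ := hlift S₁ hS₁ hG₁
  obtain ⟨β, rfl⟩ := hlift S₂ hS₂ hG₂
  by_contra hne
  have hrange : ¬ Set.range α ⊆ Set.range β := by
    intro hsub
    have heq : Set.range α = Set.range β := by
      refine Set.eq_of_subset_of_ncard_le hsub ?_ (Set.finite_range β)
      rw [← Set.image_univ, ← Set.image_univ, Set.ncard_image_of_injective _ β.injective,
        Set.ncard_image_of_injective _ α.injective]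
    refine hne ?_
    have : ∀ γ : G ↪g Q, (Set.range fun x => φ id Rigid.id (γ x)) =
        φ id Rigid.id '' Set.range γ := fun γ => Set.range_comp _ _
    rw [this, this, heq]
  obtain ⟨s, ⟨x, hx⟩, hsβ⟩ := Set.not_subset.1 hrange
  let h : Fin (k + 1) → ℕ → ℕ := fun i => delay (2 * s + 1) k i
  have hle : ∀ i : Fin (k + 1), (i : ℕ) ≤ k := fun i => Nat.lt_succ_iff.1 i.2
  have hh : ∀ i, Rigid (h i) := fun i => rigid_delay (by omega) (hle i)
  have hsame : ∀ i a, a ≠ s → φ (h i) (hh i) a = φ (h 0) (hh 0) a := by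
    intro i a ha
    rw [hφ _ (hh i), hφ _ (hh 0)]
    exact congrArg ι (pullWord_delay_of_ne Q hF ha (hle i))
  have hdiff : ∀ i i', φ (h i) (hh i) s = φ (h i') (hh i') s → i = i' := by
    intro i i' hi
    rw [hφ _ (hh i), hφ _ (hh i')] at hi
    obtain ⟨n, hn⟩ := hF (2 * s + 1 + i)
    obtain ⟨n', hn'⟩ := hF (2 * s + 1 + i')
    have hlen := congrArg List.length (ι.injective hi)
    rw [length_pullWord _ ((isFirstOcc_delay_self (by omega) (hle i)).comp hn),
      length_pullWord _ ((isFirstOcc_delay_self (by omega) (hle i')).comp hn')] at hlen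
    have h1 := hn.1
    have h2 := hn'.1
    rw [hlen] at h1
    exact Fin.ext (by omega)
  let A : Fin (k + 1) → Set V := fun i => Set.range fun x => φ (h i) (hh i) (α x)
  have hA : Function.Injective A := by
    intro i i' hi
    have hmem : φ (h i) (hh i) s ∈ A i' := hi ▸ ⟨x, by simp only [hx]⟩
    obtain ⟨y, hy⟩ := hmem
    simp only at hy
    by_cases hys : α y = s
    · rw [hys] at hy
      exact (hdiff _ _ hy).symm
    · rw [hsame i' _ hys, ← hsame i _ hys] at hy
      exact absurd ((φ (h i) (hh i)).injective hy) hys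
  have hB : ∀ i, (Set.range fun x => φ (h i) (hh i) (β x)) =
      Set.range fun x => φ (h 0) (hh 0) (β x) := by
    intro i
    congr 1
    funext y
    exact hsame i _ fun hy => hsβ ⟨y, hy⟩
  obtain ⟨T, hTk, hT⟩ := hbd (c (Set.range fun x => φ (h 0) (hh 0) (β x)))
  have hAT : ∀ i, A i ∈ T := by
    intro i
    refine hT _ ⟨((φ (h i) (hh i)).comp α).isoInduceRange⟩ ?_
    rw [← hB i]
    exact (hcan α β id (h i) Rigid.id (hh i)).1 hc
  have hcard := Finset.card_le_card_of_injOn (s := Finset.univ) A (fun i _ => hAT i) hA.injOn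
  rw [Finset.card_univ, Fintype.card_fin] at hcard
  omega
end

section
/- (Komjáth–Rödl) Let H₃ be a universal triangle-free graph. For every coloring of the vertices of H₃ into finitely many colors, there is an induced subgraph H of H₃ isomorphic to H₃ all of whose vertices have the same color. -/
/-- The Henson extension property (defining the universal triangle-free graph `H₃`): for all
disjoint finite sets `U, W` of vertices with `U` independent, there is a vertex (outside
`U ∪ W`) adjacent to every vertex of `U` and to no vertex of `W`. -/
def HensonExtProp {V : Type} (H : SimpleGraph V) : Prop :=
  ∀ U W : Finset V, Disjoint U W → (∀ u ∈ U, ∀ u' ∈ U, ¬ H.Adj u u') →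
    ∃ v : V, v ∉ U ∧ v ∉ W ∧ (∀ u ∈ U, H.Adj v u) ∧ (∀ w ∈ W, ¬ H.Adj v w)

/-- `(J, X)` describes the vertices whose neighbourhood within `X` is `J`; it is persistently
realized in `S` if every independent refinement of this description is realized by a vertex
of `S`. -/
def PersistentlyRealized {V : Type} (H : SimpleGraph V) (S : Set V) (J X : Finset V) : Prop :=
  ∀ J' X' : Finset V, X ⊆ X' → J' ⊆ X' → (∀ u ∈ J', ∀ u' ∈ J', ¬ H.Adj u u') →
    (∀ x ∈ X, x ∈ J' ↔ x ∈ J) → ∃ v ∈ S, v ∉ X' ∧ ∀ x ∈ X', H.Adj v x ↔ x ∈ J'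

/-- Beyond every finite set there is a description persistently realized in `S`. -/
def IsRich {V : Type} (H : SimpleGraph V) (S : Set V) : Prop :=
  ∀ D : Finset V, ∃ J X : Finset V, D ⊆ X ∧ J ⊆ X ∧ Disjoint J D ∧
    (∀ u ∈ J, ∀ u' ∈ J, ¬ H.Adj u u') ∧ PersistentlyRealized H S J X

lemma HensonExtProp.isRich_univ {V : Type} {H : SimpleGraph V} (hH : HensonExtProp H) :
    IsRich H Set.univ := by
  classical
  intro D
  refine ⟨∅, D, subset_rfl, by simp, by simp, by simp, ?_⟩
  intro J' X' _ hJX hJ _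
  obtain ⟨v, hvJ, hvX, hJv, hXv⟩ := hH J' (X' \ J') Finset.disjoint_sdiff hJ
  refine ⟨v, trivial, fun h => hvX (by simp [h, hvJ]), fun x hx => ⟨fun h => ?_, hJv x⟩⟩
  by_contra hxJ
  exact hXv x (by simp [hx, hxJ]) h

lemma not_isRich_empty {V : Type} (H : SimpleGraph V) : ¬ IsRich H ∅ := by
  intro h
  obtain ⟨J, X, -, hJX, -, hJ, hP⟩ := h ∅
  obtain ⟨v, hv, -⟩ := hP J X subset_rfl hJX hJ fun _ _ => Iff.rfl
  exact hv

lemma IsRich.of_union {V : Type} {H : SimpleGraph V} {S T : Set V} (h : IsRich H (S ∪ T)) :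
    IsRich H S ∨ IsRich H T := by
  classical
  by_contra! ⟨hS, hT⟩
  apply hS
  unfold IsRich at hT
  push Not at hT
  obtain ⟨D', hD'⟩ := hT
  intro D
  obtain ⟨J, X, hDX, hJX, hJD, hJ, hP⟩ := h (D ∪ D')
  rw [Finset.disjoint_union_right] at hJD
  have hnot := hD' J X (Finset.union_subset_right hDX) hJX hJD.2 hJ
  unfold PersistentlyRealized at hnot
  push Not at hnot
  obtain ⟨J', X', hXX', hJX', hJ', hiff, hmiss⟩ := hnot
  refine ⟨J', X', (Finset.union_subset_left hDX).trans hXX', hJX', ?_, hJ', ?_⟩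
  · rw [Finset.disjoint_left]
    intro x hx hxD
    exact Finset.disjoint_left.1 hJD.1
      ((hiff x (hDX (Finset.mem_union_left _ hxD))).1 hx) hxD
  · intro K Y hXY hKY hK hKJ
    obtain ⟨v, hv, hvY, hvK⟩ := hP K Y (hXX'.trans hXY) hKY hK
      fun x hx => (hKJ x (hXX' hx)).trans (hiff x hx)
    refine ⟨v, hv.resolve_right fun hvT => ?_, hvY, hvK⟩
    obtain ⟨x, hx, hne⟩ := hmiss v hvT fun hv' => hvY (hXY hv')
    have h1 := hvK x (hXY hx)
    have h2 := hKJ x hx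
    tauto

lemma IsRich.exists_color {V ι : Type} {H : SimpleGraph V} (c : V → ι) (t : Finset ι)
    (h : IsRich H {v | c v ∈ t}) : ∃ ε, IsRich H {v | c v = ε} := by
  classical
  induction t using Finset.induction_on with
  | empty => exact absurd (by simpa using h) (not_isRich_empty H)
  | insert a t _ ih =>
    have hU : {v | c v ∈ insert a t} = {v | c v = a} ∪ {v | c v ∈ t} := by
      ext v; simp
    rw [hU] at h
    exact h.of_union.elim (fun h => ⟨a, h⟩) ih

lemma exists_seq_of_extend {α : Type} [Inhabited α] (P : ℕ → (ℕ → α) → Prop)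
    (hcongr : ∀ n f g, (∀ i < n, f i = g i) → P n f → P n g) (h0 : P 0 fun _ => default)
    (hstep : ∀ n f, P n f → ∃ a, P (n + 1) (Function.update f n a)) :
    ∃ f, ∀ n, P n f := by
  choose a ha using hstep
  let s : ∀ n, {f // P n f} := fun n =>
    Nat.rec ⟨_, h0⟩ (fun n f => ⟨Function.update f.1 n (a n f.1 f.2), ha n f.1 f.2⟩) n
  have hs : ∀ n i, i < n → (s n).1 i = (s (i + 1)).1 i := by
    intro n
    induction n with
    | zero => intro i hi; omega
    | succ n ih =>
      intro i hi
      rcases Nat.lt_succ_iff_lt_or_eq.1 hi with hi | rfl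
      · rw [← ih i hi]
        exact Function.update_of_ne hi.ne _ _
      · rfl
  exact ⟨fun i => (s (i + 1)).1 i, fun n => hcongr n _ _ (hs n) (s n).2⟩

/-- The requirements on the `i`-th stage of the construction of a copy of `G` in `S`: the vertex
`b i` is the image of `i`, and later vertices whose first neighbour is `b i` are to be chosen
adjacent to `J i`. -/
structure CopyStage {V : Type} (H : SimpleGraph V) (S : Set V) (G : SimpleGraph ℕ)
    (b : ℕ → V) (J X : ℕ → Finset V) (i : ℕ) : Prop where
  subset : J i ⊆ X i
  indep : ∀ u ∈ J i, ∀ u' ∈ J i, ¬ H.Adj u u'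
  persistent : PersistentlyRealized H S (J i) (X i)
  mem : b i ∈ S
  prev_mem : ∀ j < i, b j ∈ X i
  prev_notMem : ∀ j < i, b j ∉ J i
  mono : ∀ j < i, X j ⊆ X i
  disj : ∀ j < i, Disjoint (J i) (X j)
  notMem : ∀ j ≤ i, b i ∉ X j
  adj_iff : ∀ j < i, H.Adj (b i) (b j) ↔ G.Adj i j
  adj_helper : ∀ j ≤ i, ∀ x ∈ J j, H.Adj (b i) x → j < i ∧ G.Adj i j

lemma CopyStage.congr {V : Type} {H : SimpleGraph V} {S : Set V} {G : SimpleGraph ℕ}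
    {b b' : ℕ → V} {J J' X X' : ℕ → Finset V} {i : ℕ} (h : CopyStage H S G b J X i)
    (hb : ∀ j ≤ i, b j = b' j) (hJ : ∀ j ≤ i, J j = J' j) (hX : ∀ j ≤ i, X j = X' j) :
    CopyStage H S G b' J' X' i where
  subset := by rw [← hJ i le_rfl, ← hX i le_rfl]; exact h.subset
  indep := by rw [← hJ i le_rfl]; exact h.indep
  persistent := by rw [← hJ i le_rfl, ← hX i le_rfl]; exact h.persistent
  mem := by rw [← hb i le_rfl]; exact h.mem
  prev_mem j hj := by rw [← hb j hj.le, ← hX i le_rfl]; exact h.prev_mem j hj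
  prev_notMem j hj := by rw [← hb j hj.le, ← hJ i le_rfl]; exact h.prev_notMem j hj
  mono j hj := by rw [← hX j hj.le, ← hX i le_rfl]; exact h.mono j hj
  disj j hj := by rw [← hX j hj.le, ← hJ i le_rfl]; exact h.disj j hj
  notMem j hj := by rw [← hX j hj, ← hb i le_rfl]; exact h.notMem j hj
  adj_iff j hj := by rw [← hb j hj.le, ← hb i le_rfl]; exact h.adj_iff j hj
  adj_helper j hj := by rw [← hJ j hj, ← hb i le_rfl]; exact h.adj_helper j hj

lemma SimpleGraph.CliqueFree.not_adj_of_adj_of_adj {α : Type} {G : SimpleGraph α}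
    (hG : G.CliqueFree 3) {a b c : α} (hab : G.Adj a b) (hac : G.Adj a c) : ¬ G.Adj b c := by
  classical
  exact fun hbc => hG {a, b, c} (SimpleGraph.is3Clique_triple_iff.2 ⟨hab, hac, hbc⟩)

lemma IsRich.exists_nonadj {V : Type} {H : SimpleGraph V} {S : Set V} (hS : IsRich H S)
    (X : Finset V) : ∃ v ∈ S, v ∉ X ∧ ∀ x ∈ X, ¬ H.Adj v x := by
  obtain ⟨J, Y, hXY, hJY, hJX, hJ, hP⟩ := hS X
  obtain ⟨v, hv, hvY, hvJ⟩ := hP J Y subset_rfl hJY hJ fun _ _ => Iff.rfl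
  exact ⟨v, hv, fun h => hvY (hXY h), fun x hx h =>
    Finset.disjoint_left.1 hJX ((hvJ x (hXY hx)).1 h) hx⟩

/-- The vertex realizing stage `n` of the construction. -/
lemma CopyStage.exists_vertex {V : Type} {H : SimpleGraph V} {S : Set V} {G : SimpleGraph ℕ}
    (hS : IsRich H S) (hG : G.CliqueFree 3) {b : ℕ → V} {J X : ℕ → Finset V} {n : ℕ}
    (h : ∀ i < n, CopyStage H S G b J X i) {K Y : Finset V} (hbY : ∀ i < n, b i ∈ Y)
    (hbK : ∀ i < n, b i ∉ K) (hXY : ∀ i < n, X i ⊆ Y) (hKX : ∀ i < n, Disjoint K (X i))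
    (hKY : K ⊆ Y) :
    ∃ v ∈ S, v ∉ Y ∧ (∀ i < n, H.Adj v (b i) ↔ G.Adj n i) ∧ (∀ x ∈ K, ¬ H.Adj v x) ∧
      ∀ i < n, ∀ x ∈ J i, H.Adj v x → G.Adj n i := by
  classical
  by_cases hQ : ∃ m, m < n ∧ G.Adj n m
  · obtain ⟨hmn, hm⟩ := Nat.find_spec hQ
    have hmin : ∀ l, l < n → G.Adj n l → Nat.find hQ ≤ l := fun l h1 h2 =>
      Nat.find_min' hQ ⟨h1, h2⟩
    generalize Nat.find hQ = m at hmn hm hmin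
    set L : Finset V := ((Finset.range n).filter fun l => G.Adj n l).image b with hL
    have memL : ∀ x, x ∈ L ↔ ∃ l, l < n ∧ G.Adj n l ∧ b l = x := by
      intro x; simp [hL, and_assoc]
    have hbinj : ∀ i < n, ∀ j < n, b i = b j → i = j := by
      intro i hi j hj hij
      rcases lt_trichotomy i j with hlt | heq | hlt
      · exact absurd (hij ▸ (h j hj).prev_mem i hlt) ((h j hj).notMem j le_rfl)
      · exact heq
      · exact absurd (hij ▸ (h i hi).prev_mem j hlt) ((h i hi).notMem i le_rfl)
    have hbJ : ∀ i < n, ∀ j < n, b i ∉ J j := by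
      intro i hi j hj
      rcases lt_or_ge i j with hlt | hle
      · exact (h j hj).prev_notMem i hlt
      · exact fun hx => (h i hi).notMem j hle ((h j hj).subset hx)
    have hLJ : ∀ l, l < n → G.Adj n l → ∀ x ∈ J m, ¬ H.Adj (b l) x := by
      intro l hl hnl x hx hadj
      obtain ⟨-, hlm⟩ := (h l hl).adj_helper m (hmin l hl hnl) x hx hadj
      exact hG.not_adj_of_adj_of_adj hnl hm hlm
    have hLL : ∀ l, l < n → G.Adj n l → ∀ l', l' < n → G.Adj n l' → ¬ H.Adj (b l) (b l') := by
      intro l hl hnl l' hl' hnl' hadj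
      rcases lt_trichotomy l l' with hlt | heq | hlt
      · exact hG.not_adj_of_adj_of_adj hnl' hnl (((h l' hl').adj_iff l hlt).1 hadj.symm)
      · exact hadj.ne (heq ▸ rfl)
      · exact hG.not_adj_of_adj_of_adj hnl hnl' (((h l hl).adj_iff l' hlt).1 hadj)
    obtain ⟨v, hvS, hvY, hv⟩ := (h m hmn).persistent (J m ∪ L) Y (hXY m hmn)
      (by
        intro x hx
        rcases Finset.mem_union.1 hx with hx | hx
        · exact hXY m hmn ((h m hmn).subset hx)
        · obtain ⟨l, hl, -, rfl⟩ := (memL x).1 hx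
          exact hbY l hl)
      (by
        intro u hu u' hu' hadj
        rcases Finset.mem_union.1 hu with hu | hu <;> rcases Finset.mem_union.1 hu' with hu' | hu'
        · exact (h m hmn).indep u hu u' hu' hadj
        · obtain ⟨l, hl, hnl, rfl⟩ := (memL u').1 hu'
          exact hLJ l hl hnl u hu hadj.symm
        · obtain ⟨l, hl, hnl, rfl⟩ := (memL u).1 hu
          exact hLJ l hl hnl u' hu' hadj
        · obtain ⟨l, hl, hnl, rfl⟩ := (memL u).1 hu
          obtain ⟨l', hl', hnl', rfl⟩ := (memL u').1 hu'
          exact hLL l hl hnl l' hl' hnl' hadj)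
      (by
        intro x hx
        refine ⟨fun hx' => (Finset.mem_union.1 hx').resolve_right fun hxL => ?_,
          fun hx' => Finset.mem_union_left _ hx'⟩
        obtain ⟨l, hl, hnl, rfl⟩ := (memL x).1 hxL
        exact (h l hl).notMem m (hmin l hl hnl) hx)
    refine ⟨v, hvS, hvY, fun i hi => ?_, fun x hx hadj => ?_, fun i hi x hx hadj => ?_⟩
    · rw [hv (b i) (hbY i hi), Finset.mem_union, memL]
      constructor
      · rintro (hx | ⟨l, hl, hnl, hli⟩)
        · exact absurd hx (hbJ i hi m hmn)
        · exact hbinj l hl i hi hli ▸ hnl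
      · exact fun hni => Or.inr ⟨i, hi, hni, rfl⟩
    · rcases Finset.mem_union.1 ((hv x (hKY hx)).1 hadj) with hx' | hx'
      · exact Finset.disjoint_left.1 (hKX m hmn) hx ((h m hmn).subset hx')
      · obtain ⟨l, hl, -, rfl⟩ := (memL x).1 hx'
        exact hbK l hl hx
    · rcases Finset.mem_union.1 ((hv x (hXY i hi ((h i hi).subset hx))).1 hadj) with hx' | hx'
      · rcases lt_trichotomy i m with hlt | heq | hlt
        · exact absurd ((h i hi).subset hx) (Finset.disjoint_left.1 ((h m hmn).disj i hlt) hx')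
        · exact heq ▸ hm
        · exact absurd ((h m hmn).subset hx') (Finset.disjoint_left.1 ((h i hi).disj m hlt) hx)
      · obtain ⟨l, hl, -, rfl⟩ := (memL x).1 hx'
        exact absurd hx (hbJ l hl i hi)
  · push Not at hQ
    obtain ⟨v, hvS, hvY, hv⟩ := hS.exists_nonadj Y
    exact ⟨v, hvS, hvY, fun i hi => iff_of_false (hv _ (hbY i hi)) (hQ i hi),
      fun x hx => hv x (hKY hx),
      fun i hi x hx hadj => absurd hadj (hv x (hXY i hi ((h i hi).subset hx)))⟩

lemma IsRich.exists_copy {V : Type} {H : SimpleGraph V} {S : Set V} (hS : IsRich H S)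
    {G : SimpleGraph ℕ} (hG : G.CliqueFree 3) :
    ∃ b : ℕ → V, Function.Injective b ∧ (∀ i, b i ∈ S) ∧
      ∀ i j, H.Adj (b i) (b j) ↔ G.Adj i j := by
  classical
  obtain ⟨v₀, -⟩ := hS.exists_nonadj ∅
  have : Inhabited V := ⟨v₀⟩
  obtain ⟨f, hf⟩ := exists_seq_of_extend (α := V × Finset V × Finset V)
    (fun n f => ∀ i < n,
      CopyStage H S G (fun i => (f i).1) (fun i => (f i).2.1) (fun i => (f i).2.2) i)
    (fun n f g hfg h i hi => (h i hi).congr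
      (fun j hj => by rw [hfg j (hj.trans_lt hi)])
      (fun j hj => by rw [hfg j (hj.trans_lt hi)])
      (fun j hj => by rw [hfg j (hj.trans_lt hi)]))
    (fun i hi => absurd hi (Nat.not_lt_zero i))
    (by
      intro n f h
      obtain ⟨K, Y, hDY, hKY, hKD, hK, hP⟩ :=
        hS ((Finset.range n).biUnion fun i => insert (f i).1 (f i).2.2)
      have hbD : ∀ i < n,
          (f i).1 ∈ (Finset.range n).biUnion fun i => insert (f i).1 (f i).2.2 :=
        fun i hi => Finset.mem_biUnion.2 ⟨i, Finset.mem_range.2 hi, Finset.mem_insert_self _ _⟩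
      have hXD : ∀ i < n,
          (f i).2.2 ⊆ (Finset.range n).biUnion fun i => insert (f i).1 (f i).2.2 :=
        fun i hi x hx => Finset.mem_biUnion.2
          ⟨i, Finset.mem_range.2 hi, Finset.mem_insert_of_mem hx⟩
      have hbK : ∀ i < n, (f i).1 ∉ K := fun i hi hx =>
        Finset.disjoint_left.1 hKD hx (hbD i hi)
      have hKX : ∀ i < n, Disjoint K (f i).2.2 := fun i hi =>
        Finset.disjoint_of_subset_right (hXD i hi) hKD
      obtain ⟨v, hvS, hvY, hvb, hvK, hvJ⟩ := CopyStage.exists_vertex hS hG h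
        (fun i hi => hDY (hbD i hi)) hbK (fun i hi => (hXD i hi).trans hDY) hKX hKY
      refine ⟨(v, K, Y), fun i hi => ?_⟩
      have hne : ∀ j < n, Function.update f n (v, K, Y) j = f j := fun j hj =>
        Function.update_of_ne hj.ne _ _
      rcases Nat.lt_succ_iff_lt_or_eq.1 hi with hi | rfl
      · exact (h i hi).congr
          (fun j hj => by rw [hne j (hj.trans_lt hi)])
          (fun j hj => by rw [hne j (hj.trans_lt hi)])
          (fun j hj => by rw [hne j (hj.trans_lt hi)])
      · constructor
        · simpa using hKY
        · simpa using hK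
        · simpa using hP
        · simpa using hvS
        · intro j hj
          simpa [hne j hj] using hDY (hbD j hj)
        · intro j hj
          simpa [hne j hj] using hbK j hj
        · intro j hj
          simpa [hne j hj] using (hXD j hj).trans hDY
        · intro j hj
          simpa [hne j hj] using hKX j hj
        · intro j hj
          rcases hj.lt_or_eq with hj | rfl
          · simpa [hne j hj] using fun hx => hvY (hDY (hXD j hj hx))
          · simpa using hvY
        · intro j hj
          simpa [hne j hj] using hvb j hj
        · intro j hj x hx hadj
          rcases hj.lt_or_eq with hj | rfl
          · exact ⟨hj, hvJ j hj x (by simpa [hne j hj] using hx) (by simpa using hadj)⟩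
          · exact absurd (by simpa using hadj) (hvK x (by simpa using hx)))
  have hc := fun i => hf (i + 1) i (Nat.lt_succ_self i)
  refine ⟨fun i => (f i).1, fun i j hij => ?_, fun i => (hc i).mem, fun i j => ?_⟩
  · simp only at hij
    rcases lt_trichotomy i j with hlt | heq | hlt
    · exact absurd (hij ▸ (hc j).prev_mem i hlt) ((hc j).notMem j le_rfl)
    · exact heq
    · exact absurd (hij ▸ (hc i).prev_mem j hlt) ((hc i).notMem i le_rfl)
  · rcases lt_trichotomy i j with hlt | rfl | hlt
    · rw [H.adj_comm, G.adj_comm]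
      exact (hc j).adj_iff i hlt
    · simp
    · exact (hc i).adj_iff j hlt

lemma HensonExtProp.infinite {V : Type} {H : SimpleGraph V} (hH : HensonExtProp H) :
    Infinite V := by
  refine Infinite.of_not_fintype fun _ => ?_
  obtain ⟨v, -, hv, -⟩ := hH ∅ Finset.univ (by simp) (by simp)
  exact hv (Finset.mem_univ v)

/-- **Komjáth–Rödl.** Let `H₃` be a universal triangle-free graph.  For every coloring of
the vertices of `H₃` into finitely many colors, there is an induced subgraph of `H₃`
isomorphic to `H₃` all of whose vertices have the same color. -/
theorem komjath_rodl {V : Type} [Countable V] (H : SimpleGraph V)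
    (hTF : H.CliqueFree 3) (hH : HensonExtProp H)
    (k : ℕ) (c : V → Fin (k + 1)) :
    ∃ (W : Set V) (ε : Fin (k + 1)),
      Nonempty (H ≃g H.induce W) ∧ ∀ v ∈ W, c v = ε := by
  have := hH.infinite
  obtain ⟨e⟩ : Nonempty (V ≃ ℕ) := nonempty_equiv_of_countable
  obtain ⟨ε, hε⟩ := IsRich.exists_color c Finset.univ (by simpa using hH.isRich_univ)
  obtain ⟨b, hinj, hmem, hadj⟩ := hε.exists_copy (G := H.comap e.symm)
    (hTF.comap (SimpleGraph.Embedding.comap e.symm.toEmbedding H).toCopy.isContained)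
  refine ⟨Set.range (b ∘ e), ε, ⟨⟨Equiv.ofInjective _ (hinj.comp e.injective), ?_⟩⟩, ?_⟩
  · intro x y
    simp [hadj]
  · rintro _ ⟨x, rfl⟩
    exact hmem (e x)
end
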